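/- arXiv:2411.05808 — 2 statements merged into one kernel-verified Lean document; each statement's English description precedes it below -/
import Mathlib

section
/- As R → ∞, (R^d f(R)^k)^{−1} ∫_{(ℝ^d)^k} φ(y_1/R,…,y_k/R) h_k(y_1,…,y_k) Π_{i=1}^k f(y_i) dy converges to (∫_{(ℝ^d)^{k−1}} h_k(0,z_1,…,z_{k−1}) dz) · ∫_{ℝ^d} φ(x,…,x) |x|^{−αk} dx. -/
open MeasureTheory Filter Topology

noncomputable section

/-- Euclidean space `ℝ^d`. -/
abbrev Euc (d : ℕ) : Type := EuclideanSpace ℝ (Fin d)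

/-- Safe access to the `i`-th entry of a finite tuple of points (junk value `0` out of range). -/
def vget {d n : ℕ} (z : Fin n → Euc d) (i : ℕ) : Euc d :=
  if h : i < n then z ⟨i, h⟩ else 0

/-- The `k`-tuple `(0, z₁, …, z_{k-1})`. -/
def padFirst {d : ℕ} (k : ℕ) {n : ℕ} (z : Fin n → Euc d) : Fin k → Euc d :=
  fun j => if (j : ℕ) = 0 then 0 else vget z ((j : ℕ) - 1)

/-- The `k`-tuple `(0, z₁, …, z_{ℓ-1}, z_k, …, z_{2k-ℓ-1})`. -/
def padSecond {d : ℕ} (k ℓ : ℕ) {n : ℕ} (z : Fin n → Euc d) : Fin k → Euc d :=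
  fun j => if (j : ℕ) = 0 then 0
    else if (j : ℕ) < ℓ then vget z ((j : ℕ) - 1)
    else vget z ((j : ℕ) + k - ℓ - 1)

/-- The sub-tuple `(y₁, …, y_k)` of a `(2k-ℓ)`-tuple `y`. -/
def sel1 {d : ℕ} (k : ℕ) {n : ℕ} (y : Fin n → Euc d) : Fin k → Euc d :=
  fun i => vget y (i : ℕ)

/-- The sub-tuple `(y₁, …, y_ℓ, y_{k+1}, …, y_{2k-ℓ})` of a `(2k-ℓ)`-tuple `y`. -/
def sel2 {d : ℕ} (k ℓ : ℕ) {n : ℕ} (y : Fin n → Euc d) : Fin k → Euc d :=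
  fun i => if (i : ℕ) < ℓ then vget y (i : ℕ) else vget y ((i : ℕ) + (k - ℓ))

/-- The surface area `s_{d-1}` of the unit sphere in `ℝ^d`. -/
def sArea (d : ℕ) : ℝ := d * (volume (Metric.ball (0 : Euc d) 1)).toReal

lemma min_one_abs_sub_le_integral_add {F : ℝ → ℝ} (hF : Measurable F) {u w : ℝ}
    (huw : |w - u| ≤ 1) :
    min 1 |F w - F u| ≤ (∫ s in (0 : ℝ)..3, min 1 |F (u + s) - F u|) +
      ∫ s in (0 : ℝ)..3, min 1 |F (w + s) - F w| := by
  have hρi : ∀ x p q : ℝ,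
      IntervalIntegrable (fun s => min 1 |F (x + s) - F x|) volume p q := fun x p q => by
    refine (intervalIntegrable_const (c := (1 : ℝ))).mono_fun ?_ ?_
    · exact (by fun_prop : Measurable fun s => min 1 |F (x + s) - F x|).aestronglyMeasurable
    · refine Eventually.of_forall fun s => ?_
      have : 0 ≤ min 1 |F (x + s) - F x| := le_min zero_le_one (abs_nonneg _)
      simp [abs_of_nonneg this]
  have hnn : ∀ x : ℝ, ∀ p q, 0 ≤ᵐ[volume.restrict (Set.Ioc p q)]
      fun s => min 1 |F (x + s) - F x| := fun x p q =>
    Eventually.of_forall fun s => le_min zero_le_one (abs_nonneg _)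
  obtain ⟨hl, hr⟩ := abs_le.1 huw
  have hshift : ∀ s, u + s = w + (s - (w - u)) := fun s => by ring
  have hρi' : IntervalIntegrable (fun s => min 1 |F (w + (s - (w - u))) - F w|) volume 1 2 := by
    have := (hρi w (1 - (w - u)) (2 - (w - u))).comp_sub_right (w - u)
    simpa using this
  calc min 1 |F w - F u| = ∫ _ in (1 : ℝ)..2, min 1 |F w - F u| := by norm_num
    _ ≤ ∫ s in (1 : ℝ)..2, (min 1 |F (u + s) - F u| +
          min 1 |F (w + (s - (w - u))) - F w|) := by
        refine intervalIntegral.integral_mono_on (by norm_num) (by simp)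
          ((hρi _ _ _).add hρi') fun s _ => ?_
        rw [← hshift]
        have h1 := abs_sub_le (F w) (F (u + s)) (F u)
        rw [abs_sub_comm (F w) (F (u + s))] at h1
        have h2 := abs_nonneg (F (u + s) - F u)
        have h3 := abs_nonneg (F (u + s) - F w)
        rcases le_total 1 |F (u + s) - F u| with h4 | h4 <;>
        rcases le_total 1 |F (u + s) - F w| with h5 | h5 <;>
        simp only [h4, h5, min_eq_left, min_eq_right, min_le_iff] <;>
        first
        | (left; linarith)
        | (right; linarith)
    _ = (∫ s in (1 : ℝ)..2, min 1 |F (u + s) - F u|) +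
          ∫ s in (1 - (w - u))..(2 - (w - u)), min 1 |F (w + s) - F w| := by
        rw [intervalIntegral.integral_add (hρi _ _ _) hρi',
          intervalIntegral.integral_comp_sub_right (fun s => min 1 |F (w + s) - F w|)]
    _ ≤ _ := by
        gcongr
        · exact intervalIntegral.integral_mono_interval (by norm_num) (by norm_num) (by norm_num)
            (hnn _ _ _) (hρi _ _ _)
        · exact intervalIntegral.integral_mono_interval (by linarith) (by linarith) (by linarith)
            (hnn _ _ _) (hρi _ _ _)

lemma eventually_forall_abs_sub_lt_of_tendsto_sub {F : ℝ → ℝ} (hF : Measurable F)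
    (hlim : ∀ v, Tendsto (fun u => F (u + v) - F u) atTop (𝓝 0)) {ε : ℝ} (hε : 0 < ε) :
    ∀ᶠ u in atTop, ∀ w, |w - u| ≤ 1 → |F w - F u| < ε := by
  have hA : Tendsto (fun u => ∫ s in (0 : ℝ)..3, min 1 |F (u + s) - F u|) atTop (𝓝 0) := by
    have := intervalIntegral.tendsto_integral_filter_of_dominated_convergence
      (μ := volume) (a := 0) (b := 3) (l := atTop)
      (F := fun u s => min 1 |F (u + s) - F u|) (f := fun _ => (0 : ℝ)) (fun _ => (1 : ℝ))
      (Eventually.of_forall fun u =>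
        (by fun_prop : Measurable fun s => min 1 |F (u + s) - F u|).aestronglyMeasurable)
      (Eventually.of_forall fun u => Eventually.of_forall fun s _ => by
        rw [Real.norm_of_nonneg (le_min zero_le_one (abs_nonneg _))]
        exact min_le_left _ _)
      (by simp)
      (Eventually.of_forall fun s _ => by
        simpa using (tendsto_const_nhds (x := (1 : ℝ))).min (hlim s).abs)
    simpa using this
  have hδ : 0 < min 1 ε / 2 := by positivity
  obtain ⟨U, hU⟩ := eventually_atTop.1 (hA.eventually_lt_const hδ)
  filter_upwards [eventually_ge_atTop (U + 1)] with u hu w hw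
  have h1 := hU u (by linarith)
  have h2 := hU w (by linarith [(abs_le.1 hw).1])
  have h3 := min_one_abs_sub_le_integral_add hF hw
  have h4 : min 1 |F w - F u| < min 1 ε := by linarith
  rcases le_total 1 |F w - F u| with h5 | h5
  · rw [min_eq_left h5] at h4
    exact absurd h4 (not_lt.2 (min_le_left _ _))
  · rw [min_eq_right h5] at h4
    exact h4.trans_le (min_le_right _ _)

lemma abs_sub_le_mul_of_unit_steps {F : ℝ → ℝ} {U ε : ℝ} (hε : 0 ≤ ε)
    (hstep : ∀ u ≥ U, ∀ w, |w - u| ≤ 1 → |F w - F u| ≤ ε) (n : ℕ) :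
    ∀ u ≥ U, ∀ w ≥ u, w - u ≤ n → |F w - F u| ≤ n * ε := by
  induction n with
  | zero =>
    intro u _ w huw hw
    obtain rfl : w = u := by norm_num at hw; linarith
    simp
  | succ n ih =>
    intro u hu w huw hw
    push_cast at hw ⊢
    rcases le_total (w - u) 1 with h1 | h1
    · have := hstep u hu w (abs_le.2 ⟨by linarith, h1⟩)
      nlinarith [(Nat.cast_nonneg n : (0 : ℝ) ≤ n)]
    · have h2 := ih (u + 1) (by linarith) w (by linarith) (by linarith)
      have h3 := hstep u hu (u + 1) (by simp)
      have := abs_sub_le (F w) (F (u + 1)) (F u)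
      linarith

/-- The logarithmic form of the slowly varying part of `f`. -/
def logSlow (f : ℝ → ℝ) (α u : ℝ) : ℝ := Real.log (f (Real.exp u)) + α * u

lemma measurable_logSlow {f : ℝ → ℝ} (hf : Measurable f) (α : ℝ) :
    Measurable (logSlow f α) := by
  unfold logSlow
  fun_prop

lemma exp_logSlow_sub {f : ℝ → ℝ} (α : ℝ) {t r : ℝ} (ht : 0 < t) (hr : 0 < r)
    (hft : 0 < f t) (hftr : 0 < f (t * r)) :
    f (t * r) / f t =
      Real.exp (logSlow f α (Real.log (t * r)) - logSlow f α (Real.log t)) * r ^ (-α) := by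
  unfold logSlow
  rw [Real.exp_log ht, Real.exp_log (by positivity), Real.log_mul ht.ne' hr.ne',
    Real.rpow_def_of_pos hr, ← Real.exp_add,
    show Real.log (f (t * r)) + α * (Real.log t + Real.log r) -
      (Real.log (f t) + α * Real.log t) + Real.log r * -α =
      Real.log (f (t * r)) - Real.log (f t) by ring, Real.exp_sub, Real.exp_log hft,
    Real.exp_log hftr]

lemma tendsto_logSlow_add_sub {f : ℝ → ℝ} {α : ℝ} (hfpos : ∀ᶠ r in atTop, 0 < f r)
    (hfreg : ∀ r : ℝ, 0 < r → Tendsto (fun t => f (t * r) / f t) atTop (𝓝 (r ^ (-α)))) (v : ℝ) :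
    Tendsto (fun u => logSlow f α (u + v) - logSlow f α u) atTop (𝓝 0) := by
  have h1 := ((hfreg _ (Real.exp_pos v)).comp Real.tendsto_exp_atTop).log
    (Real.rpow_pos_of_pos (Real.exp_pos v) _).ne'
  have h2 := h1.add_const (α * v)
  rw [Real.log_rpow (Real.exp_pos v), Real.log_exp] at h2
  rw [show -α * v + α * v = 0 by ring] at h2
  refine h2.congr' ?_
  filter_upwards [Real.tendsto_exp_atTop.eventually hfpos,
    (Real.tendsto_exp_atTop.comp (tendsto_atTop_add_const_right _ v tendsto_id)).eventually hfpos]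
    with u hu huv
  simp only [Function.comp_apply, id] at huv ⊢
  rw [← Real.exp_add, Real.log_div huv.ne' hu.ne']
  unfold logSlow
  ring

/-- Karamata's uniform convergence theorem, along arbitrary filters. -/
lemma tendsto_div_of_regularlyVarying {f : ℝ → ℝ} {α : ℝ} (hfm : Measurable f)
    (hfpos : ∀ᶠ r in atTop, 0 < f r)
    (hfreg : ∀ r : ℝ, 0 < r → Tendsto (fun t => f (t * r) / f t) atTop (𝓝 (r ^ (-α))))
    {ι : Type*} {l : Filter ι} {t r : ι → ℝ} {r₀ : ℝ} (hr₀ : 0 < r₀)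
    (ht : Tendsto t l atTop) (hr : Tendsto r l (𝓝 r₀)) :
    Tendsto (fun i => f (t i * r i) / f (t i)) l (𝓝 (r₀ ^ (-α))) := by
  have hlim := tendsto_logSlow_add_sub hfpos hfreg
  have hrpos : ∀ᶠ i in l, 0 < r i := hr.eventually_const_lt hr₀
  have htr : Tendsto (fun i => t i * r i) l atTop := ht.atTop_mul_pos hr₀ hr
  have hlogr : Tendsto (fun i => Real.log (r i) - Real.log r₀) l (𝓝 0) := by
    simpa using (hr.log hr₀.ne').sub_const (Real.log r₀)
  have hlogt : Tendsto (fun i => Real.log (t i)) l atTop := Real.tendsto_log_atTop.comp ht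
  have hlogt' : Tendsto (fun i => Real.log (t i) + Real.log r₀) l atTop :=
    tendsto_atTop_add_const_right _ _ hlogt
  have h1 : Tendsto (fun i => logSlow f α (Real.log (t i * r i)) -
      logSlow f α (Real.log (t i) + Real.log r₀)) l (𝓝 0) := by
    rw [Metric.tendsto_nhds]
    intro ε hε
    filter_upwards [hlogt'.eventually (eventually_forall_abs_sub_lt_of_tendsto_sub
        (measurable_logSlow hfm α) hlim hε), hrpos, ht.eventually_gt_atTop 0,
      hlogr.eventually (Metric.closedBall_mem_nhds 0 one_pos)] with i hi hri hti hlr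
    rw [Real.dist_0_eq_abs]
    refine hi _ ?_
    rw [Real.log_mul hti.ne' hri.ne']
    simpa [Real.dist_0_eq_abs] using hlr
  have h2 : Tendsto (fun i => logSlow f α (Real.log (t i * r i)) -
      logSlow f α (Real.log (t i))) l (𝓝 0) := by
    simpa using h1.add ((hlim (Real.log r₀)).comp hlogt)
  have h3 := ((Real.continuous_exp.tendsto 0).comp h2).mul
    (hr.rpow_const (p := -α) (Or.inl hr₀.ne'))
  rw [Real.exp_zero, one_mul] at h3
  refine h3.congr' ?_
  filter_upwards [hrpos, ht.eventually_gt_atTop 0, ht.eventually hfpos, htr.eventually hfpos]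
    with i hri hti hft hftr
  exact (exp_logSlow_sub α hti hri hft hftr).symm

/-- Potter's bound for scale factors at least one. -/
lemma exists_potter_bound_one {f : ℝ → ℝ} {α β : ℝ} (hfm : Measurable f)
    (hfpos : ∀ᶠ r in atTop, 0 < f r)
    (hfreg : ∀ r : ℝ, 0 < r → Tendsto (fun t => f (t * r) / f t) atTop (𝓝 (r ^ (-α))))
    (hβ : β < α) :
    ∃ C > 0, ∀ᶠ t in atTop, ∀ r ≥ 1, f (t * r) ≤ C * r ^ (-β) * f t := by
  have hε : 0 < α - β := sub_pos.2 hβ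
  obtain ⟨U, hU⟩ := eventually_atTop.1 (eventually_forall_abs_sub_lt_of_tendsto_sub
    (measurable_logSlow hfm α) (tendsto_logSlow_add_sub hfpos hfreg) hε)
  obtain ⟨T, hT⟩ := eventually_atTop.1 hfpos
  refine ⟨Real.exp (α - β), Real.exp_pos _, ?_⟩
  filter_upwards [eventually_ge_atTop T, eventually_gt_atTop 0,
    Real.tendsto_log_atTop.eventually_ge_atTop U] with t htT ht htU r hr
  have hr0 : 0 < r := one_pos.trans_le hr
  have htr : t ≤ t * r := le_mul_of_one_le_right ht.le hr
  have hft := hT t htT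
  have hlr : 0 ≤ Real.log r := Real.log_nonneg hr
  have hlog : Real.log (t * r) = Real.log t + Real.log r := Real.log_mul ht.ne' hr0.ne'
  have hb := abs_sub_le_mul_of_unit_steps hε.le (fun u hu w hw => (hU u hu w hw).le)
    ⌈Real.log r⌉₊ (Real.log t) htU (Real.log (t * r)) (by linarith)
    (by rw [hlog, add_sub_cancel_left]; exact Nat.le_ceil _)
  have hceil := (Nat.ceil_lt_add_one hlr).le
  rw [← div_le_iff₀ hft, exp_logSlow_sub α ht hr0 hft (hT _ (htT.trans htr)),
    Real.rpow_def_of_pos hr0, Real.rpow_def_of_pos hr0, ← Real.exp_add, ← Real.exp_add,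
    Real.exp_le_exp]
  have := (le_abs_self _).trans hb
  nlinarith

lemma exists_potter_bound {f : ℝ → ℝ} {α β a : ℝ} (hfm : Measurable f)
    (hfpos : ∀ᶠ r in atTop, 0 < f r)
    (hfreg : ∀ r : ℝ, 0 < r → Tendsto (fun t => f (t * r) / f t) atTop (𝓝 (r ^ (-α))))
    (hβ0 : 0 ≤ β) (hβ : β < α) (ha : 0 < a) :
    ∃ C > 0, ∀ᶠ t in atTop, ∀ r ≥ a, f (t * r) / f t ≤ C * (1 + r) ^ (-β) := by
  obtain ⟨C, hC, hpot⟩ := exists_potter_bound_one hfm hfpos hfreg hβ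
  have hK : 0 < a ^ (-α) + 1 := by positivity
  refine ⟨C * (1 + a) ^ β * (a ^ (-α) + 1), by positivity, ?_⟩
  filter_upwards [(tendsto_id.atTop_mul_const ha).eventually hpot, hfpos,
    (hfreg a ha).eventually_lt_const (lt_add_one _)] with t hpt hft hta r hr
  have hr0 : 0 < r := ha.trans_le hr
  have h1 := hpt (r / a) ((one_le_div ha).2 hr)
  simp only [id] at h1
  rw [show t * a * (r / a) = t * r by field_simp] at h1
  have h2 : (r / a) ^ (-β) ≤ (1 + r) ^ (-β) * (1 + a) ^ β := by
    calc (r / a) ^ (-β) ≤ ((1 + r) / (1 + a)) ^ (-β) := by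
          refine Real.rpow_le_rpow_of_nonpos (by positivity) ?_ (by linarith)
          rw [div_le_div_iff₀ (by positivity) ha]
          nlinarith
      _ = _ := by
          rw [Real.div_rpow (by positivity) (by positivity), Real.rpow_neg (by positivity : 0 ≤ 1 + a),
            div_inv_eq_mul]
  calc f (t * r) / f t ≤ C * (r / a) ^ (-β) * f (t * a) / f t := by gcongr
    _ = C * (r / a) ^ (-β) * (f (t * a) / f t) := by ring
    _ ≤ C * (r / a) ^ (-β) * (a ^ (-α) + 1) := by gcongr
    _ ≤ C * ((1 + r) ^ (-β) * (1 + a) ^ β) * (a ^ (-α) + 1) := by gcongr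
    _ = _ := by ring
/-- The layered parametrisation `(x, z) ↦ (R x, R x + z₁, …, R x + z_n)` of `(n+1)`-tuples. -/
def layerMap {E : Type*} [AddCommGroup E] [Module ℝ E] (n : ℕ) (R : ℝ) (p : E × (Fin n → E)) :
    Fin (n + 1) → E :=
  Fin.cons (R • p.1) fun i => R • p.1 + p.2 i

lemma measurable_layerMap {d : ℕ} (n : ℕ) (R : ℝ) :
    Measurable (layerMap n R : Euc d × (Fin n → Euc d) → Fin (n + 1) → Euc d) := by
  refine measurable_pi_lambda _ fun i => ?_
  induction i using Fin.cases with
  | zero => simp only [layerMap, Fin.cons_zero]; fun_prop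
  | succ i => simp only [layerMap, Fin.cons_succ]; fun_prop

lemma measurePreserving_layerMap_one {d : ℕ} (n : ℕ) :
    MeasurePreserving (layerMap n 1 : Euc d × (Fin n → Euc d) → Fin (n + 1) → Euc d)
      (volume.prod volume) volume := by
  have h1 : MeasurePreserving
      (fun p : Euc d × (Fin n → Euc d) => (p.1, fun i => p.1 + p.2 i))
      (volume.prod volume) (volume.prod volume) := by
    refine (MeasurePreserving.id volume).skew_product 
      (g := fun (x : Euc d) (z : Fin n → Euc d) i => x + z i)
      (by fun_prop) ?_
    refine Eventually.of_forall fun x => ?_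
    exact map_add_left_eq_self volume (fun _ : Fin n => x)
  have h2 := (volume_preserving_piFinSuccAbove (fun _ : Fin (n + 1) => Euc d) 0).symm
  refine (congrArg (MeasurePreserving · (volume.prod volume) volume) ?_).mpr (h2.comp h1)
  refine funext fun p => funext fun i => ?_
  induction i using Fin.cases with
  | zero => simp [layerMap, MeasurableEquiv.piFinSuccAbove]
  | succ i => simp [layerMap, MeasurableEquiv.piFinSuccAbove]

lemma map_layerMap {d : ℕ} (n : ℕ) {R : ℝ} (hR : 0 < R) :
    Measure.map (layerMap n R : Euc d × (Fin n → Euc d) → Fin (n + 1) → Euc d)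
      (volume.prod volume) = ENNReal.ofReal ((R ^ d)⁻¹) • volume := by
  have h1 : (layerMap n R : Euc d × (Fin n → Euc d) → Fin (n + 1) → Euc d) =
      layerMap n 1 ∘ Prod.map (R • ·) id := by
    ext1 p
    simp [layerMap]
  have h2 : Measure.map (Prod.map (R • ·) id : Euc d × (Fin n → Euc d) → _)
      (volume.prod volume) = ENNReal.ofReal ((R ^ d)⁻¹) • volume.prod volume := by
    rw [← Measure.map_prod_map _ _ (by fun_prop) measurable_id, Measure.map_id,
      Measure.map_addHaar_smul _ hR.ne', Measure.prod_smul_left, finrank_euclideanSpace_fin,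
      abs_of_pos (by positivity)]
  rw [h1, ← Measure.map_map (measurable_layerMap n 1) (by fun_prop), h2, Measure.map_smul,
    (measurePreserving_layerMap_one n).map_eq]

lemma integral_eq_integral_layerMap {d n : ℕ} {R : ℝ} (hR : 0 < R)
    {G : (Fin (n + 1) → Euc d) → ℝ} (hG : Measurable G) :
    (R ^ d)⁻¹ * ∫ y, G y = ∫ p : Euc d × (Fin n → Euc d), G (layerMap n R p) := by
  have h1 := integral_map (μ := volume.prod volume)
    (measurable_layerMap (d := d) n R).aemeasurable (f := G) hG.aestronglyMeasurable
  rw [map_layerMap n hR, integral_smul_measure, ENNReal.toReal_ofReal (by positivity)] at h1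
  exact h1

lemma padFirst_succ {d n : ℕ} (z : Fin n → Euc d) :
    padFirst (n + 1) z = (Fin.cons 0 z : Fin (n + 1) → Euc d) := by
  refine funext fun i => ?_
  induction i using Fin.cases with
  | zero => simp [padFirst]
  | succ i => simp [padFirst, vget]

lemma smul_layerMap {E : Type*} [AddCommGroup E] [Module ℝ E] {n : ℕ} {R : ℝ} (hR : R ≠ 0)
    (p : E × (Fin n → E)) :
    (fun i => R⁻¹ • layerMap n R p i) = Fin.cons p.1 fun i => p.1 + R⁻¹ • p.2 i := by
  refine funext fun i => ?_
  induction i using Fin.cases with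
  | zero => simp [layerMap, hR]
  | succ i => simp [layerMap, hR]

/-- the analytic core of Lemma 6.1(i). -/
theorem layered_mean_asymptotics
    (d k : ℕ) (hd : 1 ≤ d) (hk : 1 ≤ k) (α : ℝ) (hα : (d : ℝ) < α)
    (f : ℝ → ℝ) (hfm : Measurable f) (hfnn : ∀ r, 0 ≤ f r)
    (hfprob : (∫ x : Euc d, f ‖x‖) = 1)
    (hfpos : ∀ᶠ r in atTop, 0 < f r)
    (hfreg : ∀ r : ℝ, 0 < r → Tendsto (fun t => f (t * r) / f t) atTop (𝓝 (r ^ (-α))))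
    (h : (Fin k → Euc d) → ℝ) (hhm : Measurable h)
    (hh01 : ∀ y, h y = 0 ∨ h y = 1)
    (hhperm : ∀ (σ : Equiv.Perm (Fin k)) (y : Fin k → Euc d), h (y ∘ σ) = h y)
    (hhtrans : ∀ (x : Euc d) (y : Fin k → Euc d), h (fun i => x + y i) = h y)
    (L : ℝ) (hL : 0 < L)
    (hhdiam : ∀ y : Fin k → Euc d, (∃ i j, L < dist (y i) (y j)) → h y = 0)
    (hh1 : k = 1 → ∀ y, h y = 1)
    (φ : (Fin k → Euc d) → ℝ) (hφc : Continuous φ) (hφnn : ∀ x, 0 ≤ φ x)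
    (hφb : ∃ M, ∀ x, φ x ≤ M)
    (hφ0 : ∃ a > 0, ∀ x : Fin k → Euc d, (∃ i, ‖x i‖ ≤ a) → φ x = 0) :
    Tendsto (fun R : ℝ =>
        (R ^ d * f R ^ k)⁻¹ *
          ∫ y : Fin k → Euc d, φ (fun i => R⁻¹ • y i) * h y * ∏ i, f ‖y i‖)
      atTop
      (𝓝 ((∫ z : Fin (k - 1) → Euc d, h (padFirst k z)) *
          ∫ x : Euc d, φ (fun _ : Fin k => x) * ‖x‖ ^ (-(α * (k : ℝ))))) := by
  obtain ⟨n, rfl⟩ : ∃ n, k = n + 1 := ⟨k - 1, by omega⟩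
  obtain ⟨M, hM⟩ := hφb
  obtain ⟨a, ha, hφa⟩ := hφ0
  obtain ⟨β, hdβ, hβα⟩ := exists_between hα
  have hβ0 : 0 ≤ β := (Nat.cast_nonneg d).trans hdβ.le
  obtain ⟨C, hC, hpot⟩ := exists_potter_bound hfm hfpos hfreg hβ0 hβα ha
  have hφm : Measurable φ := hφc.measurable
  have hM0 : 0 ≤ M := (hφnn 0).trans (hM 0)
  have hconsm : ∀ R : ℝ, Measurable fun p : Euc d × (Fin n → Euc d) =>
      (Fin.cons p.1 fun i => p.1 + R⁻¹ • p.2 i : Fin (n + 1) → Euc d) := fun R =>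
    measurable_pi_lambda _ fun i => by
      induction i using Fin.cases with
      | zero => simp only [Fin.cons_zero]; fun_prop
      | succ i => simp only [Fin.cons_succ]; fun_prop
  have hcons0 : Measurable fun z : Fin n → Euc d => (Fin.cons 0 z : Fin (n + 1) → Euc d) :=
    measurable_pi_lambda _ fun i => by
      induction i using Fin.cases with
      | zero => simp only [Fin.cons_zero]; fun_prop
      | succ i => simp only [Fin.cons_succ]; fun_prop
  have hprod : (∫ z : Fin (n + 1 - 1) → Euc d, h (padFirst (n + 1) z)) *
      (∫ x : Euc d, φ (fun _ : Fin (n + 1) => x) * ‖x‖ ^ (-(α * ((n + 1 : ℕ) : ℝ)))) =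
      ∫ p : Euc d × (Fin n → Euc d), (φ (fun _ : Fin (n + 1) => p.1) *
        ‖p.1‖ ^ (-(α * ((n + 1 : ℕ) : ℝ)))) * h (Fin.cons 0 p.2) := by
    rw [mul_comm]
    simp_rw [padFirst_succ]
    exact (integral_prod_mul (μ := (volume : Measure (Euc d)))
      (ν := (volume : Measure (Fin n → Euc d))) _ _).symm
  have hscale : ∀ R : ℝ, 0 < R →
      (R ^ d * f R ^ (n + 1))⁻¹ *
        ∫ y : Fin (n + 1) → Euc d, φ (fun i => R⁻¹ • y i) * h y * ∏ i, f ‖y i‖ =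
      ∫ p : Euc d × (Fin n → Euc d),
        φ (Fin.cons p.1 fun i => p.1 + R⁻¹ • p.2 i) * h (Fin.cons 0 p.2) *
          ∏ i, f (R * ‖(Fin.cons p.1 fun i => p.1 + R⁻¹ • p.2 i : Fin (n + 1) → Euc d) i‖) /
            f R := by
    intro R hR
    have hGm : Measurable fun y : Fin (n + 1) → Euc d =>
        φ (fun i => R⁻¹ • y i) * h y * ∏ i, f ‖y i‖ := by fun_prop
    rw [mul_inv, mul_comm (R ^ d)⁻¹, mul_assoc, integral_eq_integral_layerMap hR hGm,
      ← integral_const_mul]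
    congr 1
    ext1 p
    have hh : h (layerMap n R p) = h (Fin.cons 0 p.2) := by
      rw [← hhtrans (R • p.1) (Fin.cons 0 p.2)]
      congr 1
      refine funext fun i => ?_
      induction i using Fin.cases with
      | zero => simp [layerMap]
      | succ i => simp [layerMap]
    have hnorm : ∀ i, ‖layerMap n R p i‖ =
        R * ‖(Fin.cons p.1 fun i => p.1 + R⁻¹ • p.2 i : Fin (n + 1) → Euc d) i‖ := fun i => by
      rw [← smul_layerMap hR.ne' p, norm_smul, norm_inv, Real.norm_of_nonneg hR.le,
        mul_inv_cancel_left₀ hR.ne']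
    rw [smul_layerMap hR.ne', hh]
    simp_rw [hnorm]
    rw [Finset.prod_div_distrib, Finset.prod_const, Finset.card_univ, Fintype.card_fin]
    ring
  rw [hprod]
  refine Tendsto.congr' (f₁ := fun R => ∫ p : Euc d × (Fin n → Euc d),
        φ (Fin.cons p.1 fun i => p.1 + R⁻¹ • p.2 i) * h (Fin.cons 0 p.2) *
          ∏ i, f (R * ‖(Fin.cons p.1 fun i => p.1 + R⁻¹ • p.2 i : Fin (n + 1) → Euc d) i‖) /
            f R) ?_ ?_
  · filter_upwards [eventually_gt_atTop 0] with R hR using (hscale R hR).symm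
  refine tendsto_integral_filter_of_dominated_convergence
    (fun p : Euc d × (Fin n → Euc d) => (M * C ^ (n + 1) * (1 + ‖p.1‖) ^ (-β)) *
      (Metric.closedBall (0 : Fin n → Euc d) L).indicator (fun _ => (1 : ℝ)) p.2) ?_ ?_ ?_ ?_
  · refine Eventually.of_forall fun R => Measurable.aestronglyMeasurable ?_
    refine ((hφm.comp (hconsm R)).mul (hhm.comp (hcons0.comp measurable_snd))).mul ?_
    refine Finset.measurable_prod _ fun i _ => ?_
    have := (measurable_pi_apply i).comp (hconsm R)
    exact (hfm.comp (this.norm.const_mul R)).div_const _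
  · filter_upwards [hpot, hfpos] with R hpR hfR
    refine Eventually.of_forall fun p => ?_
    set w : Fin (n + 1) → Euc d := Fin.cons p.1 fun i => p.1 + R⁻¹ • p.2 i with hw
    have hg : 0 ≤ M * C ^ (n + 1) * (1 + ‖p.1‖) ^ (-β) := by positivity
    have hrhs : 0 ≤ (M * C ^ (n + 1) * (1 + ‖p.1‖) ^ (-β)) *
        (Metric.closedBall (0 : Fin n → Euc d) L).indicator (fun _ => (1 : ℝ)) p.2 :=
      mul_nonneg hg (Set.indicator_nonneg (fun _ _ => zero_le_one) _)
    rcases hh01 (Fin.cons 0 p.2) with h0 | h1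
    · simpa [h0] using hrhs
    by_cases hwa : ∃ i, ‖w i‖ ≤ a
    · simpa [hφa w hwa] using hrhs
    push Not at hwa
    have hmem : p.2 ∈ Metric.closedBall (0 : Fin n → Euc d) L := by
      rw [mem_closedBall_zero_iff, pi_norm_le_iff_of_nonneg hL.le]
      intro i
      by_contra! hi
      have := hhdiam (Fin.cons 0 p.2) ⟨i.succ, 0, by simpa using hi⟩
      exact zero_ne_one (this.symm.trans h1)
    rw [Set.indicator_of_mem hmem, h1, mul_one, mul_one]
    have hnn : ∀ i, 0 ≤ f (R * ‖w i‖) / f R := fun i => div_nonneg (hfnn _) hfR.le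
    rw [Real.norm_of_nonneg (mul_nonneg (hφnn _) (Finset.prod_nonneg fun i _ => hnn i)),
      Fin.prod_univ_succ]
    have htail : ∏ i : Fin n, f (R * ‖w i.succ‖) / f R ≤ C ^ n := by
      calc ∏ i : Fin n, f (R * ‖w i.succ‖) / f R ≤ ∏ _i : Fin n, C := by
            refine Finset.prod_le_prod (fun i _ => hnn _) fun i _ => ?_
            refine (hpR _ (hwa _).le).trans (mul_le_of_le_one_right hC.le ?_)
            exact Real.rpow_le_one_of_one_le_of_nonpos (by simp) (by linarith)
        _ = C ^ n := by simp
    calc φ w * (f (R * ‖w 0‖) / f R * ∏ i : Fin n, f (R * ‖w i.succ‖) / f R)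
        ≤ M * (C * (1 + ‖w 0‖) ^ (-β) * C ^ n) := by
          gcongr
          · exact mul_nonneg (hnn _) (Finset.prod_nonneg fun i _ => hnn _)
          · exact hM _
          · exact Finset.prod_nonneg fun i _ => hnn _
          · exact hpR _ (hwa 0).le
      _ = M * C ^ (n + 1) * (1 + ‖p.1‖) ^ (-β) := by
          rw [hw, Fin.cons_zero]; ring
  · refine Integrable.mul_prod (μ := (volume : Measure (Euc d)))
      (ν := (volume : Measure (Fin n → Euc d)))
      (f := fun x => M * C ^ (n + 1) * (1 + ‖x‖) ^ (-β)) ?_ ?_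
    · exact (integrable_one_add_norm (by simpa using hdβ)).const_mul _
    · rw [integrable_indicator_iff Metric.isClosed_closedBall.measurableSet]
      exact integrableOn_const (isCompact_closedBall _ _).measure_lt_top.ne
  · refine Eventually.of_forall fun p => ?_
    have hlimw : ∀ i, Tendsto (fun R : ℝ =>
        (Fin.cons p.1 fun i => p.1 + R⁻¹ • p.2 i : Fin (n + 1) → Euc d) i) atTop (𝓝 p.1) := by
      intro i
      induction i using Fin.cases with
      | zero => simp
      | succ i =>
        simpa using ((tendsto_inv_atTop_zero (𝕜 := ℝ)).smul_const (p.2 i)).const_add p.1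
    have hφlim : Tendsto (fun R : ℝ => φ (Fin.cons p.1 fun i => p.1 + R⁻¹ • p.2 i)) atTop
        (𝓝 (φ fun _ => p.1)) := (hφc.tendsto _).comp (tendsto_pi_nhds.2 hlimw)
    rcases eq_or_ne p.1 0 with hp | hp
    · have hz : ∀ R : ℝ, φ (Fin.cons p.1 fun i => p.1 + R⁻¹ • p.2 i) = 0 := fun R =>
        hφa _ ⟨0, by simp [hp, ha.le]⟩
      have hz' : φ (fun _ => p.1) = 0 := hφa _ ⟨0, by simp [hp, ha.le]⟩
      simp [hz, hz']
    have hp' : 0 < ‖p.1‖ := norm_pos_iff.2 hp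
    have hf' := tendsto_finsetProd (Finset.univ : Finset (Fin (n + 1))) fun i _ =>
      tendsto_div_of_regularlyVarying hfm hfpos hfreg hp' tendsto_id (hlimw i).norm
    rw [Finset.prod_const, Finset.card_univ, Fintype.card_fin, ← Real.rpow_mul_natCast hp'.le,
      neg_mul] at hf'
    have := (hφlim.mul_const (h (Fin.cons 0 p.2))).mul hf'
    rw [mul_right_comm] at this
    exact this
end
end

section
/- Assume that n f(R_k(C_k n/m)) converges as n → ∞ either to 0, to some ξ ∈ (0,∞), or to ∞. For 1 ≤ ℓ ≤ k define I_ℓ(n) := ∫_{(ℝ^d)^{2k−ℓ}} φ_1((y_1,…,y_k)/R) h_k(y_1,…,y_k) φ_2((y_1,…,y_ℓ,y_{k+1},…,y_{2k−ℓ})/R) h_k(y_1,…,y_ℓ,y_{k+1},…,y_{2k−ℓ}) Π_{i=1}^{2k−ℓ} f(y_i) dy, where R = R_k(C_k n/m). Then τ_{k,n}^{−1} Σ_{ℓ=1}^k n^{2k−ℓ} I_ℓ(n)/(ℓ!·((k−ℓ)!)²) converges to V_k(φ_1,φ_2) as n → ∞. (By the multivariate Mecke formula, the left-hand side equals τ_{k,n}^{−1}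 Cov(ν_{k,n}(φ_1), ν_{k,n}(φ_2)) for the layered tail empirical measure of the Poisson process with intensity n f.) -/
open MeasureTheory Filter Topology

noncomputable section

/-- The constant `D_{k,ℓ}` of the paper. -/
def Dfun (d k ℓ : ℕ) (h : (Fin k → Euc d) → ℝ) : ℝ :=
  ∫ z : Fin (2 * k - ℓ - 1) → Euc d, h (padFirst k z) * h (padSecond k ℓ z)

/-- The diagonal integral `∫ φ₁(x,…,x) φ₂(x,…,x) |x|^{-e} dx`. -/
def diagInt (d k : ℕ) (φ₁ φ₂ : (Fin k → Euc d) → ℝ) (e : ℝ) : ℝ :=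
  ∫ x : Euc d, φ₁ (fun _ : Fin k => x) * φ₂ (fun _ : Fin k => x) * ‖x‖ ^ (-e)

/-- The `ℓ`-overlap integral `I_ℓ(n)` (computed at radius `R`). -/
def Ifun (d k ℓ : ℕ) (f : ℝ → ℝ) (h : (Fin k → Euc d) → ℝ)
    (φ₁ φ₂ : (Fin k → Euc d) → ℝ) (R : ℝ) : ℝ :=
  ∫ y : Fin (2 * k - ℓ) → Euc d,
    φ₁ (fun i : Fin k => R⁻¹ • sel1 k y i) * h (sel1 k y) *
      (φ₂ (fun i : Fin k => R⁻¹ • sel2 k ℓ y i) * h (sel2 k ℓ y)) *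
      ∏ i, f ‖y i‖

/-- `Σ_{ℓ=1}^k n^{2k-ℓ} I_ℓ(n)/(ℓ!((k-ℓ)!)²)`. -/
def Sfun (d k : ℕ) (f : ℝ → ℝ) (h : (Fin k → Euc d) → ℝ)
    (φ₁ φ₂ : (Fin k → Euc d) → ℝ) (R : ℝ) (n : ℕ) : ℝ :=
  ∑ ℓ ∈ Finset.Icc 1 k,
    (n : ℝ) ^ (2 * k - ℓ) * Ifun d k ℓ f h φ₁ φ₂ R /
      ((Nat.factorial ℓ : ℝ) * (Nat.factorial (k - ℓ) : ℝ) ^ 2)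

theorem tendsto_zero_of_min_one_abs {ι : Type*} {l : Filter ι} {t : ι → ℝ}
    (ht : Tendsto (fun i => min 1 |t i|) l (𝓝 0)) : Tendsto t l (𝓝 0) := by
  rw [Metric.tendsto_nhds] at ht ⊢
  intro ε hε
  filter_upwards [ht (min ε 1) (by positivity)] with i hi
  rw [Real.dist_eq, sub_zero] at hi ⊢
  rw [abs_of_nonneg (by positivity), lt_min_iff, min_lt_iff, min_lt_iff] at hi
  grind

/-- The uniform convergence theorem for additively slowly varying functions. -/
theorem tendsto_uniform_of_additive_slowly_varying {g : ℝ → ℝ} (hg : Measurable g)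
    (H : ∀ u, Tendsto (fun x => g (x + u) - g x) atTop (𝓝 0)) :
    Tendsto (fun p : ℝ × ℝ => g (p.1 + p.2) - g p.1)
      (atTop ×ˢ 𝓟 (Set.Icc (-1) 1)) (𝓝 0) := by
  have hmeas : ∀ a b : ℝ, Measurable fun v => min 1 |g (a + v) - b| := by
    intro a b
    fun_prop
  have hbd : ∀ t : ℝ, ‖min 1 |t|‖ ≤ 1 := by
    intro t
    rw [Real.norm_of_nonneg (by positivity)]
    exact min_le_left _ _
  have hint : ∀ a b c d : ℝ, IntervalIntegrable (fun v => min 1 |g (a + v) - b|) volume c d := by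
    intro a b c d
    exact (intervalIntegrable_const (c := (1 : ℝ))).mono_fun (hmeas a b).aestronglyMeasurable
      (Eventually.of_forall fun v => by simpa using hbd _)
  have hfst : Tendsto (fun p : ℝ × ℝ => p.1) (atTop ×ˢ 𝓟 (Set.Icc (-1 : ℝ) 1)) atTop :=
    tendsto_fst
  have hsum : Tendsto (fun p : ℝ × ℝ => p.1 + p.2) (atTop ×ˢ 𝓟 (Set.Icc (-1 : ℝ) 1)) atTop := by
    have h1 : Tendsto (fun p : ℝ × ℝ => p.1 + -1) (atTop ×ˢ 𝓟 (Set.Icc (-1 : ℝ) 1)) atTop :=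
      tendsto_atTop_add_const_right _ _ hfst
    refine tendsto_atTop_mono' _ ?_ h1
    have h2 : ∀ᶠ p : ℝ × ℝ in atTop ×ˢ 𝓟 (Set.Icc (-1 : ℝ) 1), p.2 ∈ Set.Icc (-1 : ℝ) 1 :=
      tendsto_snd.eventually (mem_principal_self _)
    filter_upwards [h2] with p hp
    linarith [hp.1]
  have hlim : ∀ (q : ℝ × ℝ → ℝ) (c d : ℝ), Tendsto q (atTop ×ˢ 𝓟 (Set.Icc (-1 : ℝ) 1)) atTop →
      Tendsto (fun p => ∫ v in c..d, min 1 |g (q p + v) - g (q p)|)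
        (atTop ×ˢ 𝓟 (Set.Icc (-1 : ℝ) 1)) (𝓝 0) := by
    intro q c d hq
    have := intervalIntegral.tendsto_integral_filter_of_dominated_convergence (μ := volume)
      (a := c) (b := d) (l := atTop ×ˢ 𝓟 (Set.Icc (-1 : ℝ) 1))
      (F := fun p v => min 1 |g (q p + v) - g (q p)|) (f := fun _ => (0 : ℝ)) (fun _ => 1)
      (Eventually.of_forall fun p => (hmeas _ _).aestronglyMeasurable)
      (Eventually.of_forall fun p => Eventually.of_forall fun v _ => hbd _)
      intervalIntegrable_const
      (Eventually.of_forall fun v _ => by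
        have h1 := ((H v).comp hq).abs
        have h2 := (tendsto_const_nhds (x := (1 : ℝ))).min h1
        simpa using h2)
    simpa using this
  have h1 := (hlim (fun p => p.1 + p.2) 0 1 hsum).add (hlim (fun p => p.1) (-1) 2 hfst)
  rw [add_zero] at h1
  apply tendsto_zero_of_min_one_abs
  refine squeeze_zero' (Eventually.of_forall fun p => by positivity) ?_ h1
  have h2 : ∀ᶠ p : ℝ × ℝ in atTop ×ˢ 𝓟 (Set.Icc (-1 : ℝ) 1), p.2 ∈ Set.Icc (-1 : ℝ) 1 :=
    tendsto_snd.eventually (mem_principal_self _)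
  filter_upwards [h2] with p hp
  have e1 : min 1 |g (p.1 + p.2) - g p.1| = ∫ _ in (0 : ℝ)..1, min 1 |g (p.1 + p.2) - g p.1| := by
    simp
  have e2 : (∫ _ in (0 : ℝ)..1, min 1 |g (p.1 + p.2) - g p.1|) ≤
      ∫ w in (0 : ℝ)..1, (min 1 |g (p.1 + p.2 + w) - g (p.1 + p.2)| +
        min 1 |g (p.1 + p.2 + w) - g p.1|) := by
    apply intervalIntegral.integral_mono_on (by norm_num) intervalIntegrable_const
      ((hint _ _ _ _).add (hint _ _ _ _))
    intro w _
    have := abs_sub_le (g (p.1 + p.2)) (g (p.1 + p.2 + w)) (g p.1)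
    rw [abs_sub_comm (g (p.1 + p.2)) (g (p.1 + p.2 + w))] at this
    have n1 := abs_nonneg (g (p.1 + p.2 + w) - g (p.1 + p.2))
    have n2 := abs_nonneg (g (p.1 + p.2 + w) - g p.1)
    simp only [min_def]
    split_ifs <;> linarith
  rw [intervalIntegral.integral_add (hint _ _ _ _) (hint _ _ _ _)] at e2
  have e3 : (∫ w in (0 : ℝ)..1, min 1 |g (p.1 + p.2 + w) - g p.1|) =
      ∫ v in (p.2 + 0)..(p.2 + 1), min 1 |g (p.1 + v) - g p.1| := by
    rw [← intervalIntegral.integral_comp_add_left (fun v => min 1 |g (p.1 + v) - g p.1|)]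
    simp only [add_assoc]
  have e4 : (∫ v in (p.2 + 0)..(p.2 + 1), min 1 |g (p.1 + v) - g p.1|) ≤
      ∫ v in (-1)..2, min 1 |g (p.1 + v) - g p.1| := by
    apply intervalIntegral.integral_mono_interval
    · linarith [hp.1]
    · linarith
    · linarith [hp.2]
    · exact Eventually.of_forall fun v => by simp only [Pi.zero_apply]; positivity
    · exact hint _ _ _ _
  linarith

/-- Linear growth bound for increments of an additively slowly varying function. -/
theorem exists_abs_increment_le_of_additive_slowly_varying {g : ℝ → ℝ} (hg : Measurable g)
    (H : ∀ u, Tendsto (fun x => g (x + u) - g x) atTop (𝓝 0)) {δ : ℝ} (hδ : 0 < δ) :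
    ∃ X, ∀ x ≥ X, ∀ u, 0 ≤ u → |g (x + u) - g x| ≤ δ * (u + 1) := by
  have h1 := tendsto_uniform_of_additive_slowly_varying hg H
  rw [Metric.tendsto_nhds] at h1
  have h2 := h1 δ hδ
  rw [eventually_prod_principal_iff, eventually_atTop] at h2
  obtain ⟨X, hX⟩ := h2
  simp only [Real.dist_eq, sub_zero] at hX
  refine ⟨X, ?_⟩
  have key : ∀ n : ℕ, ∀ x ≥ X, ∀ u, (n : ℝ) ≤ u → u ≤ n + 1 → |g (x + u) - g x| ≤ δ * (n + 1) := by
    intro n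
    induction n with
    | zero =>
      intro x hx u hu hu'
      have := hX x hx u ⟨by push_cast at *; linarith, by push_cast at *; linarith⟩
      push_cast
      linarith
    | succ n ih =>
      intro x hx u hu hu'
      push_cast at *
      have a1 := ih (x + 1) (by linarith) (u - 1) (by linarith) (by linarith)
      have a2 := hX x hx 1 ⟨by norm_num, le_rfl⟩
      rw [show x + 1 + (u - 1) = x + u by ring] at a1
      have a3 := abs_sub_le (g (x + u)) (g (x + 1)) (g x)
      linarith
  intro x hx u hu
  have a1 := key ⌊u⌋₊ x hx u (Nat.floor_le hu) (Nat.lt_floor_add_one u).le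
  have a2 := Nat.floor_le hu
  nlinarith

section RegularVariation

variable {f : ℝ → ℝ} {α : ℝ}

theorem tendsto_log_increment_of_regularly_varying
    (hfpos : ∀ᶠ r in atTop, 0 < f r)
    (hfreg : ∀ r : ℝ, 0 < r → Tendsto (fun t => f (t * r) / f t) atTop (𝓝 (r ^ (-α)))) (u : ℝ) :
    Tendsto (fun x => (Real.log (f (Real.exp (x + u))) + α * (x + u)) -
      (Real.log (f (Real.exp x)) + α * x)) atTop (𝓝 0) := by
  have h1 := (hfreg (Real.exp u) (Real.exp_pos u)).comp Real.tendsto_exp_atTop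
  have h2 := (h1.log (by positivity)).add_const (α * u)
  rw [Real.log_rpow (Real.exp_pos u), Real.log_exp, neg_mul, neg_add_cancel] at h2
  refine h2.congr' ?_
  filter_upwards [Real.tendsto_exp_atTop.eventually hfpos,
    (Real.tendsto_exp_atTop.comp (tendsto_atTop_add_const_right atTop u tendsto_id)).eventually
      hfpos] with x hx hx'
  simp only [Function.comp_apply, id] at hx' ⊢
  rw [← Real.exp_add, Real.log_div hx'.ne' hx.ne']
  ring

/-- A Potter bound for regularly varying functions. -/
theorem exists_le_rpow_mul_of_regularly_varying (hfm : Measurable f)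
    (hfpos : ∀ᶠ r in atTop, 0 < f r)
    (hfreg : ∀ r : ℝ, 0 < r → Tendsto (fun t => f (t * r) / f t) atTop (𝓝 (r ^ (-α))))
    {β : ℝ} (hβ : β < α) :
    ∃ C > 0, ∃ t₀ > 0, ∀ t ≥ t₀, ∀ r, 1 ≤ r → f (t * r) ≤ C * r ^ (-β) * f t := by
  obtain ⟨X, hX⟩ := exists_abs_increment_le_of_additive_slowly_varying
    (g := fun x => Real.log (f (Real.exp x)) + α * x) (by fun_prop)
    (tendsto_log_increment_of_regularly_varying hfpos hfreg) (sub_pos.2 hβ)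
  obtain ⟨P, hP⟩ := eventually_atTop.1 hfpos
  refine ⟨Real.exp (α - β), Real.exp_pos _, max (Real.exp X) P, by positivity, ?_⟩
  intro t ht r hr
  have htX : Real.exp X ≤ t := (le_max_left _ _).trans ht
  have htP : P ≤ t := (le_max_right _ _).trans ht
  have ht0 : 0 < t := (Real.exp_pos X).trans_le htX
  have hr0 : 0 < r := by linarith
  have hft : 0 < f t := hP t htP
  have hfs : 0 < f (t * r) := hP _ (htP.trans (by nlinarith))
  have h1 := hX (Real.log t) ((Real.le_log_iff_exp_le ht0).2 htX) (Real.log r) (Real.log_nonneg hr)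
  rw [← Real.log_mul ht0.ne' hr0.ne', Real.exp_log (by positivity), Real.exp_log ht0,
    Real.log_mul ht0.ne' hr0.ne'] at h1
  have h2 := (abs_le.1 h1).2
  rw [← Real.log_le_log_iff hfs (by positivity), Real.log_mul (by positivity) hft.ne',
    Real.log_mul (by positivity) (by positivity), Real.log_exp, Real.log_rpow hr0]
  linarith

theorem exists_div_le_one_add_rpow_of_regularly_varying (hfm : Measurable f)
    (hfpos : ∀ᶠ r in atTop, 0 < f r)
    (hfreg : ∀ r : ℝ, 0 < r → Tendsto (fun t => f (t * r) / f t) atTop (𝓝 (r ^ (-α))))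
    {β : ℝ} (hβ0 : 0 < β) (hβ : β < α) {a : ℝ} (ha : 0 < a) :
    ∃ C, 0 ≤ C ∧ ∀ᶠ R in atTop, ∀ r, a ≤ r → f (R * r) / f R ≤ C * (1 + r) ^ (-β) := by
  obtain ⟨C, hC, t₀, ht₀, hb⟩ := exists_le_rpow_mul_of_regularly_varying hfm hfpos hfreg hβ
  set A : ℝ := a ^ (-α) + 1 with hA
  have hApos : 0 < A := by positivity
  refine ⟨C * (((1 + a) ^ β)) * A, by positivity, ?_⟩
  filter_upwards [hfpos, (hfreg a ha).eventually (gt_mem_nhds (lt_add_one (a ^ (-α)))),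
    (tendsto_id.atTop_mul_const ha).eventually_ge_atTop t₀,
    (tendsto_id.atTop_mul_const ha).eventually hfpos] with R h1 h2 h3 h4 r hr
  simp only [id] at h3 h4
  have hr0 : 0 < r := ha.trans_le hr
  have h5 := hb (R * a) h3 (r / a) ((one_le_div ha).2 hr)
  rw [show R * a * (r / a) = R * r by field_simp] at h5
  have h6 : (r / a) ^ (-β) ≤ (1 + a) ^ β * (1 + r) ^ (-β) := by
    rw [Real.rpow_neg (by positivity), Real.rpow_neg (by positivity), ← Real.inv_rpow (by positivity),
      ← Real.inv_rpow (by positivity), ← Real.mul_rpow (by positivity) (by positivity)]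
    apply Real.rpow_le_rpow (by positivity) _ hβ0.le
    rw [inv_div, ← div_eq_mul_inv, div_le_div_iff₀ hr0 (by positivity)]
    nlinarith
  calc f (R * r) / f R ≤ (C * (r / a) ^ (-β) * f (R * a)) / f R := by gcongr
    _ = C * (r / a) ^ (-β) * (f (R * a) / f R) := by ring
    _ ≤ C * ((1 + a) ^ β * (1 + r) ^ (-β)) * A := by gcongr
    _ = _ := by ring

theorem tendsto_div_of_regularly_varying (hfm : Measurable f)
    (hfpos : ∀ᶠ r in atTop, 0 < f r)
    (hfreg : ∀ r : ℝ, 0 < r → Tendsto (fun t => f (t * r) / f t) atTop (𝓝 (r ^ (-α))))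
    {c : ℝ} (hc : 0 < c) {s : ℝ → ℝ} (hs : Tendsto s atTop (𝓝 c)) :
    Tendsto (fun R => f (R * s R) / f R) atTop (𝓝 (c ^ (-α))) := by
  have h0 := tendsto_uniform_of_additive_slowly_varying
    (g := fun x => Real.log (f (Real.exp x)) + α * x) (by fun_prop)
    (tendsto_log_increment_of_regularly_varying hfpos hfreg)
  have hlogR : Tendsto (fun R : ℝ => Real.log (R * c)) atTop atTop :=
    Real.tendsto_log_atTop.comp (tendsto_id.atTop_mul_const hc)
  have hls : Tendsto (fun R => Real.log (s R) - Real.log c) atTop (𝓝 0) := by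
    simpa using (hs.log hc.ne').sub_const (Real.log c)
  have h1 := h0.comp (hlogR.prodMk (tendsto_principal.2 (hls.eventually
    (Icc_mem_nhds (show (-1 : ℝ) < 0 by norm_num) (show (0 : ℝ) < 1 by norm_num)))))
  have h2 : Tendsto (fun R => Real.log (f (R * s R) / f (R * c))) atTop (𝓝 0) := by
    have h3 := h1.sub (hls.const_mul α)
    simp only [mul_zero, sub_zero] at h3
    refine h3.congr' ?_
    have hs0 : ∀ᶠ R in atTop, 0 < s R := hs.eventually (lt_mem_nhds hc)
    filter_upwards [hs0, eventually_gt_atTop 0,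
      (tendsto_id.atTop_mul_const hc).eventually hfpos,
      (tendsto_id.atTop_mul_pos hc hs).eventually hfpos] with R hsR hR hf1 hf2
    simp only [id, Function.comp_apply] at *
    rw [Real.log_div hf2.ne' hf1.ne', Real.exp_log (by positivity),
      show Real.log (R * c) + (Real.log (s R) - Real.log c) = Real.log (R * s R) by
        rw [Real.log_mul hR.ne' hc.ne', Real.log_mul hR.ne' hsR.ne']; ring,
      Real.exp_log (by positivity), Real.log_mul hR.ne' hc.ne', Real.log_mul hR.ne' hsR.ne']
    ring
  have h3 := h2.rexp.mul (hfreg c hc)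
  rw [Real.exp_zero, one_mul] at h3
  refine h3.congr' ?_
  filter_upwards [hfpos, (tendsto_id.atTop_mul_const hc).eventually hfpos,
      (tendsto_id.atTop_mul_pos hc hs).eventually hfpos] with R hf0 hf1 hf2
  simp only [id] at hf1 hf2
  rw [Real.exp_log (by positivity)]
  field_simp

end RegularVariation

section Tuples

variable {d : ℕ}

theorem vget_of_lt {n i : ℕ} (y : Fin n → Euc d) (hi : i < n) : vget y i = y ⟨i, hi⟩ :=
  dif_pos hi

theorem measurable_vget (n i : ℕ) : Measurable fun y : Fin n → Euc d => vget y i := by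
  unfold vget
  split_ifs
  · fun_prop
  · fun_prop

theorem measurable_sel1 (k n : ℕ) : Measurable fun y : Fin n → Euc d => sel1 k y :=
  measurable_pi_lambda _ fun _ => measurable_vget _ _

theorem measurable_sel2 (k ℓ n : ℕ) : Measurable fun y : Fin n → Euc d => sel2 k ℓ y := by
  refine measurable_pi_lambda _ fun i => ?_
  unfold sel2
  split_ifs
  · exact measurable_vget _ _
  · exact measurable_vget _ _

theorem vget_cons {N i : ℕ} (z : Fin N → Euc d) (hi : 0 < i) :
    vget (Fin.cons 0 z : Fin (N + 1) → Euc d) i = vget z (i - 1) := by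
  obtain ⟨j, rfl⟩ : ∃ j, i = j + 1 := ⟨i - 1, by omega⟩
  simp only [vget, Nat.add_sub_cancel, Nat.add_lt_add_iff_right]
  rfl

theorem padFirst_eq_sel1_cons (k : ℕ) {N : ℕ} (z : Fin N → Euc d) :
    padFirst k z = sel1 k (Fin.cons 0 z : Fin (N + 1) → Euc d) := by
  funext ⟨i, hi⟩
  rcases Nat.eq_zero_or_pos i with rfl | hi0
  · simp [padFirst, sel1, vget]
  · simp only [padFirst, sel1, hi0.ne', if_false, vget_cons z hi0]

theorem padSecond_eq_sel2_cons {k ℓ : ℕ} (hℓ : 1 ≤ ℓ) (hℓk : ℓ ≤ k) {N : ℕ}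
    (z : Fin N → Euc d) :
    padSecond k ℓ z = sel2 k ℓ (Fin.cons 0 z : Fin (N + 1) → Euc d) := by
  funext ⟨i, hi⟩
  rcases Nat.eq_zero_or_pos i with rfl | hi0
  · simp [padSecond, sel2, vget, show 0 < ℓ by omega]
  · simp only [padSecond, sel2, hi0.ne', if_false]
    split_ifs
    · rw [vget_cons z hi0]
    · rw [vget_cons z (by omega)]
      congr 1
      omega

theorem sel1_const_add {k n : ℕ} (hkn : k ≤ n) (x : Euc d) (w : Fin n → Euc d) :
    sel1 k (fun i => x + w i) = fun i => x + sel1 k w i := by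
  funext i
  simp only [sel1]
  rw [vget_of_lt _ (i.2.trans_le hkn), vget_of_lt _ (i.2.trans_le hkn)]

theorem sel2_const_add {k ℓ n : ℕ} (hkn : n = 2 * k - ℓ) (hℓk : ℓ ≤ k) (x : Euc d)
    (w : Fin n → Euc d) :
    sel2 k ℓ (fun i => x + w i) = fun i => x + sel2 k ℓ w i := by
  funext i
  have hi := i.2
  simp only [sel2]
  split_ifs
  · rw [vget_of_lt _ (by omega), vget_of_lt _ (by omega)]
  · rw [vget_of_lt _ (by omega), vget_of_lt _ (by omega)]

/-- Every entry of a `(2k-ℓ)`-tuple appears in one of its two sub-tuples. -/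
theorem exists_sel1_or_sel2_eq {k ℓ n : ℕ} (hkn : n = 2 * k - ℓ) (hℓk : ℓ ≤ k)
    (y : Fin n → Euc d) (j : Fin n) :
    (∃ i, sel1 k y i = y j) ∨ ∃ i, sel2 k ℓ y i = y j := by
  have hj := j.2
  by_cases hjk : (j : ℕ) < k
  · exact Or.inl ⟨⟨j, hjk⟩, vget_of_lt _ hj⟩
  · refine Or.inr ⟨⟨j - (k - ℓ), by omega⟩, ?_⟩
    simp only [sel2]
    rw [if_neg (by omega), vget_of_lt _ (by omega)]
    congr 1
    ext
    simp only
    omega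

end Tuples

section ChangeOfVariables

variable {d : ℕ}

/-- The tuple `(R x, R x + z₁, …, R x + z_N)`. -/
def clusterMap {N : ℕ} (R : ℝ) (p : Euc d × (Fin N → Euc d)) : Fin (N + 1) → Euc d :=
  fun i => R • p.1 + (Fin.cons 0 p.2 : Fin (N + 1) → Euc d) i

theorem measurable_clusterMap {N : ℕ} (R : ℝ) :
    Measurable (clusterMap R : Euc d × (Fin N → Euc d) → _) := by
  refine measurable_pi_lambda _ fun i => ?_
  unfold clusterMap
  refine Fin.cases ?_ (fun j => ?_) i
  · simp only [Fin.cons_zero]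
    fun_prop
  · simp only [Fin.cons_succ]
    fun_prop

theorem map_clusterMap_volume {N : ℕ} {R : ℝ} (hR : 0 < R) :
    Measure.map (clusterMap R : Euc d × (Fin N → Euc d) → _) volume =
      ENNReal.ofReal (R ^ d)⁻¹ • volume := by
  have hscale : Measure.map (Prod.map (fun x : Euc d => R • x) (id : (Fin N → Euc d) → _)) volume =
      ENNReal.ofReal (R ^ d)⁻¹ • volume := by
    rw [Measure.volume_eq_prod, ← Measure.map_prod_map _ _ (by fun_prop) measurable_id,
      Measure.map_addHaar_smul _ hR.ne', Measure.map_id, Measure.prod_smul_left,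
      finrank_euclideanSpace_fin, abs_of_pos (by positivity)]
  have hshear : MeasurePreserving (fun p : Euc d × (Fin N → Euc d) => (p.1, (fun _ => p.1) + p.2))
      volume volume := by
    refine (MeasurePreserving.id volume).skew_product (g := fun x z => (fun _ => x) + z) ?_ ?_
    · simp only [Function.uncurry_def]
      fun_prop
    · exact Eventually.of_forall fun x => map_add_left_eq_self volume _
  have hcons := (volume_preserving_piFinSuccAbove (fun _ : Fin (N + 1) => Euc d) 0).symm
  have hcomp : (clusterMap R : Euc d × (Fin N → Euc d) → _) =
      ((MeasurableEquiv.piFinSuccAbove (fun _ : Fin (N + 1) => Euc d) 0).symm ∘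
        (fun p : Euc d × (Fin N → Euc d) => (p.1, (fun _ => p.1) + p.2))) ∘
          Prod.map (fun x : Euc d => R • x) id := by
    funext p i
    refine Fin.cases ?_ (fun j => ?_) i
    · simp [clusterMap, MeasurableEquiv.piFinSuccAbove]
    · simp [clusterMap, MeasurableEquiv.piFinSuccAbove]
  rw [hcomp, ← Measure.map_map (hcons.comp hshear).measurable (by fun_prop), hscale,
    Measure.map_smul, (hcons.comp hshear).map_eq]

theorem integral_comp_clusterMap {N : ℕ} {R : ℝ} (hR : 0 < R) {G : (Fin (N + 1) → Euc d) → ℝ}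
    (hG : Measurable G) :
    ∫ p : Euc d × (Fin N → Euc d), G (clusterMap R p) = (R ^ d)⁻¹ * ∫ y, G y := by
  rw [← integral_map (measurable_clusterMap R).aemeasurable hG.aestronglyMeasurable,
    map_clusterMap_volume hR, integral_smul_measure, ENNReal.toReal_ofReal (by positivity),
    smul_eq_mul]

end ChangeOfVariables

section OverlapIntegral

variable {d k ℓ N : ℕ}

theorem eq_zero_of_norm_le_of_forall_eq_zero {φ : (Fin k → Euc d) → ℝ} {a b : ℝ} (hab : b ≤ a)
    (hφ : ∀ x : Fin k → Euc d, (∃ i, ‖x i‖ ≤ a) → φ x = 0) :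
    ∀ x : Fin k → Euc d, (∃ i, ‖x i‖ ≤ b) → φ x = 0 :=
  fun x ⟨i, hi⟩ => hφ x ⟨i, hi.trans hab⟩

/-- The clusters selected by both indicators have all displacements bounded by `L`. -/
theorem norm_le_of_indicator_ne_zero {h : (Fin k → Euc d) → ℝ} {L : ℝ}
    (hhdiam : ∀ y : Fin k → Euc d, (∃ i j, L < dist (y i) (y j)) → h y = 0)
    (hℓ : 1 ≤ ℓ) (hℓk : ℓ ≤ k) (hN : N + 1 = 2 * k - ℓ) {z : Fin N → Euc d}
    (h1 : h (padFirst k z) ≠ 0) (h2 : h (padSecond k ℓ z) ≠ 0) (j : Fin N) : ‖z j‖ ≤ L := by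
  have hk : 0 < k := by omega
  have key : ∀ y : Fin k → Euc d, h y ≠ 0 → y ⟨0, hk⟩ = 0 → ∀ i, ‖y i‖ ≤ L := by
    intro y hy hy0 i
    by_contra hlt
    refine hy (hhdiam y ⟨i, ⟨0, hk⟩, ?_⟩)
    rw [hy0, dist_zero_right]
    exact not_le.1 hlt
  rcases exists_sel1_or_sel2_eq hN hℓk (Fin.cons 0 z : Fin (N + 1) → Euc d) j.succ with
    ⟨i, hi⟩ | ⟨i, hi⟩
  · rw [← padFirst_eq_sel1_cons, Fin.cons_succ] at hi
    rw [← hi]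
    exact key _ h1 (by simp [padFirst]) i
  · rw [← padSecond_eq_sel2_cons hℓ hℓk, Fin.cons_succ] at hi
    rw [← hi]
    exact key _ h2 (by simp [padSecond]) i

theorem tendsto_comp_rescaled {φ : (Fin k → Euc d) → ℝ} (hφ : Continuous φ) (x : Euc d)
    (w : Fin k → Euc d) :
    Tendsto (fun R : ℝ => φ (fun i => R⁻¹ • (R • x + w i))) atTop (𝓝 (φ fun _ => x)) := by
  refine (hφ.tendsto _).comp (tendsto_pi_nhds.2 fun i => ?_)
  have h1 : Tendsto (fun R : ℝ => x + R⁻¹ • w i) atTop (𝓝 x) := by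
    simpa using ((tendsto_inv_atTop_zero (𝕜 := ℝ)).smul_const (w i)).const_add x
  refine h1.congr' ?_
  filter_upwards [eventually_gt_atTop 0] with R hR
  rw [smul_add, inv_smul_smul₀ hR.ne']

theorem tendsto_density_ratio {f : ℝ → ℝ} {α : ℝ} (hfm : Measurable f)
    (hfpos : ∀ᶠ r in atTop, 0 < f r)
    (hfreg : ∀ r : ℝ, 0 < r → Tendsto (fun t => f (t * r) / f t) atTop (𝓝 (r ^ (-α))))
    {x : Euc d} (hx : x ≠ 0) (w : Euc d) :
    Tendsto (fun R : ℝ => f ‖R • x + w‖ / f R) atTop (𝓝 (‖x‖ ^ (-α))) := by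
  have h1 : Tendsto (fun R : ℝ => ‖x + R⁻¹ • w‖) atTop (𝓝 ‖x‖) := by
    simpa using (((tendsto_inv_atTop_zero (𝕜 := ℝ)).smul_const w).const_add x).norm
  refine (tendsto_div_of_regularly_varying hfm hfpos hfreg (norm_pos_iff.2 hx) h1).congr' ?_
  filter_upwards [eventually_gt_atTop 0] with R hR
  rw [← norm_smul_of_nonneg hR.le, smul_add, smul_inv_smul₀ hR.ne']

/-- Asymptotics of the overlap integral. -/
theorem tendsto_overlap_integral_div {n : ℕ} (hn : n = N + 1) (hkn : n = 2 * k - ℓ)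
    (hℓ : 1 ≤ ℓ) (hℓk : ℓ ≤ k) {α : ℝ} (hα : (d : ℝ) < α)
    {f : ℝ → ℝ} (hfm : Measurable f) (hfnn : ∀ r, 0 ≤ f r)
    (hfpos : ∀ᶠ r in atTop, 0 < f r)
    (hfreg : ∀ r : ℝ, 0 < r → Tendsto (fun t => f (t * r) / f t) atTop (𝓝 (r ^ (-α))))
    {h : (Fin k → Euc d) → ℝ} (hhm : Measurable h)
    (hh01 : ∀ y, h y = 0 ∨ h y = 1)
    (hhtrans : ∀ (x : Euc d) (y : Fin k → Euc d), h (fun i => x + y i) = h y)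
    {L : ℝ} (hhdiam : ∀ y : Fin k → Euc d, (∃ i j, L < dist (y i) (y j)) → h y = 0)
    {φ₁ : (Fin k → Euc d) → ℝ} (hφ₁c : Continuous φ₁) (hφ₁nn : ∀ x, 0 ≤ φ₁ x)
    (hφ₁b : ∃ M, ∀ x, φ₁ x ≤ M)
    (hφ₁0 : ∃ a > 0, ∀ x : Fin k → Euc d, (∃ i, ‖x i‖ ≤ a) → φ₁ x = 0)
    {φ₂ : (Fin k → Euc d) → ℝ} (hφ₂c : Continuous φ₂) (hφ₂nn : ∀ x, 0 ≤ φ₂ x)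
    (hφ₂b : ∃ M, ∀ x, φ₂ x ≤ M)
    (hφ₂0 : ∃ a > 0, ∀ x : Fin k → Euc d, (∃ i, ‖x i‖ ≤ a) → φ₂ x = 0) :
    Tendsto (fun R : ℝ => (∫ y : Fin n → Euc d,
        φ₁ (fun i : Fin k => R⁻¹ • sel1 k y i) * h (sel1 k y) *
          (φ₂ (fun i : Fin k => R⁻¹ • sel2 k ℓ y i) * h (sel2 k ℓ y)) *
          ∏ i, f ‖y i‖) / (R ^ d * f R ^ n)) atTop
      (𝓝 ((∫ z : Fin N → Euc d, h (padFirst k z) * h (padSecond k ℓ z)) *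
        diagInt d k φ₁ φ₂ (α * (n : ℝ)))) := by
  subst hn
  have hk : 0 < k := by omega
  obtain ⟨a₁, ha₁, hφ₁0⟩ := hφ₁0
  obtain ⟨a₂, ha₂, hφ₂0⟩ := hφ₂0
  obtain ⟨a, ha, hφ₁0, hφ₂0⟩ : ∃ a > 0,
      (∀ x : Fin k → Euc d, (∃ i, ‖x i‖ ≤ a) → φ₁ x = 0) ∧
      ∀ x : Fin k → Euc d, (∃ i, ‖x i‖ ≤ a) → φ₂ x = 0 :=
    ⟨min a₁ a₂, lt_min ha₁ ha₂, eq_zero_of_norm_le_of_forall_eq_zero (min_le_left _ _) hφ₁0,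
      eq_zero_of_norm_le_of_forall_eq_zero (min_le_right _ _) hφ₂0⟩
  obtain ⟨M₁, hM₁⟩ := hφ₁b
  obtain ⟨M₂, hM₂⟩ := hφ₂b
  have hM₁0 : 0 ≤ M₁ := (hφ₁nn 0).trans (hM₁ 0)
  have hM₂0 : 0 ≤ M₂ := (hφ₂nn 0).trans (hM₂ 0)
  obtain ⟨β, hdβ, hβα⟩ := exists_between hα
  have hβ0 : 0 < β := (Nat.cast_nonneg d).trans_lt hdβ
  obtain ⟨C, hC, hPotter⟩ :=
    exists_div_le_one_add_rpow_of_regularly_varying hfm hfpos hfreg hβ0 hβα ha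
  have hh0 : ∀ y, 0 ≤ h y := fun y => by rcases hh01 y with e | e <;> simp [e]
  have hh1 : ∀ y, h y ≤ 1 := fun y => by rcases hh01 y with e | e <;> simp [e]
  set G : ℝ → (Fin (N + 1) → Euc d) → ℝ := fun R y =>
    φ₁ (fun i : Fin k => R⁻¹ • sel1 k y i) * h (sel1 k y) *
      (φ₂ (fun i : Fin k => R⁻¹ • sel2 k ℓ y i) * h (sel2 k ℓ y)) * ∏ i, f ‖y i‖ with hG
  have hGm : ∀ R, Measurable (G R) := by
    intro R
    have m1 := measurable_sel1 (d := d) k (N + 1)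
    have m2 := measurable_sel2 (d := d) k ℓ (N + 1)
    have m3 : Measurable fun y : Fin (N + 1) → Euc d => fun i : Fin k => R⁻¹ • sel1 k y i :=
      m1.const_smul R⁻¹
    have m4 : Measurable fun y : Fin (N + 1) → Euc d => fun i : Fin k => R⁻¹ • sel2 k ℓ y i :=
      m2.const_smul R⁻¹
    have m5 : Measurable fun y : Fin (N + 1) → Euc d => ∏ i, f ‖y i‖ :=
      Finset.measurable_fun_prod _ fun i _ => hfm.comp (measurable_pi_apply i).norm
    exact (((hφ₁c.measurable.comp m3).mul (hhm.comp m1)).mul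
      ((hφ₂c.measurable.comp m4).mul (hhm.comp m2))).mul m5
  have hGform : ∀ R (p : Euc d × (Fin N → Euc d)), G R (clusterMap R p) / f R ^ (N + 1) =
      φ₁ (fun i => R⁻¹ • (R • p.1 + padFirst k p.2 i)) *
        φ₂ (fun i => R⁻¹ • (R • p.1 + padSecond k ℓ p.2 i)) *
        (h (padFirst k p.2) * h (padSecond k ℓ p.2)) *
        ∏ i, f ‖clusterMap R p i‖ / f R := by
    intro R p
    have e1 : sel1 k (clusterMap R p) = fun i => R • p.1 + padFirst k p.2 i := by
      rw [padFirst_eq_sel1_cons]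
      exact sel1_const_add (by omega) _ _
    have e2 : sel2 k ℓ (clusterMap R p) = fun i => R • p.1 + padSecond k ℓ p.2 i := by
      rw [padSecond_eq_sel2_cons hℓ hℓk]
      exact sel2_const_add hkn hℓk _ _
    simp only [hG, e1, e2, hhtrans]
    rw [Finset.prod_div_distrib, Finset.prod_const, Finset.card_univ, Fintype.card_fin]
    ring
  have hlim : Tendsto (fun R => ∫ p : Euc d × (Fin N → Euc d),
      G R (clusterMap R p) / f R ^ (N + 1)) atTop
      (𝓝 (∫ p : Euc d × (Fin N → Euc d),
        (φ₁ (fun _ => p.1) * φ₂ (fun _ => p.1) * ‖p.1‖ ^ (-(α * ((N + 1 : ℕ) : ℝ)))) *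
          (h (padFirst k p.2) * h (padSecond k ℓ p.2)))) := by
    refine tendsto_integral_filter_of_dominated_convergence
      (fun p => (M₁ * M₂ * C ^ (N + 1)) * ((1 + ‖p.1‖) ^ (-β) *
        (Metric.closedBall (0 : Fin N → Euc d) L).indicator (fun _ => (1 : ℝ)) p.2)) ?_ ?_ ?_ ?_
    · exact Eventually.of_forall fun R =>
        (((hGm R).comp (measurable_clusterMap R)).div_const _).aestronglyMeasurable
    · filter_upwards [hPotter, hfpos, eventually_gt_atTop 0] with R hP hfR hR
      refine Eventually.of_forall fun p => ?_
      rw [hGform]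
      have hbnn : 0 ≤ (M₁ * M₂ * C ^ (N + 1)) * ((1 + ‖p.1‖) ^ (-β) *
          (Metric.closedBall (0 : Fin N → Euc d) L).indicator (fun _ => (1 : ℝ)) p.2) := by
        have : 0 ≤ (Metric.closedBall (0 : Fin N → Euc d) L).indicator (fun _ => (1 : ℝ)) p.2 :=
          Set.indicator_nonneg (fun _ _ => zero_le_one) _
        positivity
      by_cases c1 : φ₁ (fun i => R⁻¹ • (R • p.1 + padFirst k p.2 i)) = 0
      · simpa only [c1, zero_mul, mul_zero, norm_zero] using hbnn
      by_cases c2 : φ₂ (fun i => R⁻¹ • (R • p.1 + padSecond k ℓ p.2 i)) = 0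
      · simpa only [c2, zero_mul, mul_zero, norm_zero] using hbnn
      by_cases c3 : h (padFirst k p.2) = 0
      · simpa only [c3, zero_mul, mul_zero, norm_zero] using hbnn
      by_cases c4 : h (padSecond k ℓ p.2) = 0
      · simpa only [c4, zero_mul, mul_zero, norm_zero] using hbnn
      have hL0 : 0 ≤ L := by
        by_contra hneg
        exact c3 (hhdiam _ ⟨⟨0, hk⟩, ⟨0, hk⟩, by simpa using hneg⟩)
      have hz : p.2 ∈ Metric.closedBall (0 : Fin N → Euc d) L := by
        rw [mem_closedBall_zero_iff, pi_norm_le_iff_of_nonneg hL0]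
        exact norm_le_of_indicator_ne_zero hhdiam hℓ hℓk hkn c3 c4
      rw [Set.indicator_of_mem hz, mul_one]
      have hlarge : ∀ j, a ≤ ‖R⁻¹ • clusterMap R p j‖ := by
        intro j
        by_contra hlt
        rcases exists_sel1_or_sel2_eq hkn hℓk (Fin.cons 0 p.2 : Fin (N + 1) → Euc d) j with
          ⟨i, hi⟩ | ⟨i, hi⟩
        · rw [← padFirst_eq_sel1_cons] at hi
          refine c1 (hφ₁0 _ ⟨i, ?_⟩)
          simp only [hi]
          exact (not_le.1 hlt).le
        · rw [← padSecond_eq_sel2_cons hℓ hℓk] at hi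
          refine c2 (hφ₂0 _ ⟨i, ?_⟩)
          simp only [hi]
          exact (not_le.1 hlt).le
      have hratio : ∀ j, f ‖clusterMap R p j‖ / f R ≤
          C * (1 + ‖R⁻¹ • clusterMap R p j‖) ^ (-β) := by
        intro j
        have := hP _ (hlarge j)
        rwa [← norm_smul_of_nonneg hR.le, smul_inv_smul₀ hR.ne'] at this
      have hzero : R⁻¹ • clusterMap R p 0 = p.1 := by
        simp [clusterMap, inv_smul_smul₀ hR.ne']
      have hprod : ∏ i, f ‖clusterMap R p i‖ / f R ≤ C ^ (N + 1) * (1 + ‖p.1‖) ^ (-β) := by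
        rw [Fin.prod_univ_succ]
        have q1 := hratio 0
        rw [hzero] at q1
        have q2 : ∏ i : Fin N, f ‖clusterMap R p i.succ‖ / f R ≤ C ^ N := by
          calc ∏ i : Fin N, f ‖clusterMap R p i.succ‖ / f R ≤ ∏ _i : Fin N, C := by
                refine Finset.prod_le_prod (fun i _ => div_nonneg (hfnn _) hfR.le) fun i _ => ?_
                refine (hratio i.succ).trans (mul_le_of_le_one_right hC ?_)
                exact Real.rpow_le_one_of_one_le_of_nonpos
                  (le_add_of_nonneg_right (norm_nonneg _)) (neg_nonpos.2 hβ0.le)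
            _ = C ^ N := by simp
        calc _ ≤ (C * (1 + ‖p.1‖) ^ (-β)) * C ^ N := by
              refine mul_le_mul q1 q2 ?_ (by positivity)
              exact Finset.prod_nonneg fun i _ => div_nonneg (hfnn _) hfR.le
          _ = _ := by ring
      have hprod0 : 0 ≤ ∏ i, f ‖clusterMap R p i‖ / f R :=
        Finset.prod_nonneg fun i _ => div_nonneg (hfnn _) hfR.le
      have hhh : h (padFirst k p.2) * h (padSecond k ℓ p.2) ≤ 1 :=
        mul_le_one₀ (hh1 _) (hh0 _) (hh1 _)
      have hhh0 : 0 ≤ h (padFirst k p.2) * h (padSecond k ℓ p.2) := mul_nonneg (hh0 _) (hh0 _)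
      rw [Real.norm_of_nonneg (mul_nonneg (mul_nonneg (mul_nonneg (hφ₁nn _) (hφ₂nn _)) hhh0)
        hprod0)]
      calc _ ≤ (M₁ * M₂) * 1 * (C ^ (N + 1) * (1 + ‖p.1‖) ^ (-β)) := by
            refine mul_le_mul (mul_le_mul (mul_le_mul (hM₁ _) (hM₂ _) (hφ₂nn _) hM₁0) hhh hhh0
              (by positivity)) hprod hprod0 (by positivity)
        _ = _ := by ring
    · refine Integrable.const_mul ?_ _
      rw [Measure.volume_eq_prod]
      refine Integrable.mul_prod (f := fun x : Euc d => (1 + ‖x‖) ^ (-β))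
        (g := (Metric.closedBall (0 : Fin N → Euc d) L).indicator fun _ => (1 : ℝ)) ?_ ?_
      · exact integrable_one_add_norm (by simpa using hdβ)
      · rw [integrable_indicator_iff Metric.isClosed_closedBall.measurableSet]
        exact integrableOn_const (isCompact_closedBall _ _).measure_lt_top.ne
    · refine Eventually.of_forall fun p => ?_
      simp only [hGform]
      by_cases hx : p.1 = 0
      · have z1 : ∀ R : ℝ, φ₁ (fun i => R⁻¹ • (R • p.1 + padFirst k p.2 i)) = 0 := fun R =>
          hφ₁0 _ ⟨⟨0, hk⟩, by simp [hx, padFirst, ha.le]⟩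
        have z2 : φ₁ (fun _ => p.1) = 0 := hφ₁0 _ ⟨⟨0, hk⟩, by simp [hx, ha.le]⟩
        simp only [z1, z2, zero_mul]
        exact tendsto_const_nhds
      · have t1 := tendsto_comp_rescaled hφ₁c p.1 (padFirst k p.2)
        have t2 := tendsto_comp_rescaled hφ₂c p.1 (padSecond k ℓ p.2)
        have t3 : Tendsto (fun R : ℝ => ∏ i, f ‖clusterMap R p i‖ / f R) atTop
            (𝓝 (∏ _i : Fin (N + 1), ‖p.1‖ ^ (-α))) :=
          tendsto_finsetProd _ fun i _ => tendsto_density_ratio hfm hfpos hfreg hx _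
        have t4 := ((t1.mul t2).mul_const (h (padFirst k p.2) * h (padSecond k ℓ p.2))).mul t3
        rw [Finset.prod_const, Finset.card_univ, Fintype.card_fin, ← Real.rpow_mul_natCast
          (norm_nonneg _), neg_mul] at t4
        convert t4 using 2
        ring
  have hsplit : (∫ p : Euc d × (Fin N → Euc d),
        (φ₁ (fun _ => p.1) * φ₂ (fun _ => p.1) * ‖p.1‖ ^ (-(α * ((N + 1 : ℕ) : ℝ)))) *
          (h (padFirst k p.2) * h (padSecond k ℓ p.2))) =
      (∫ z : Fin N → Euc d, h (padFirst k z) * h (padSecond k ℓ z)) *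
        diagInt d k φ₁ φ₂ (α * ((N + 1 : ℕ) : ℝ)) := by
    rw [Measure.volume_eq_prod, integral_prod_mul (fun x : Euc d =>
      φ₁ (fun _ => x) * φ₂ (fun _ => x) * ‖x‖ ^ (-(α * ((N + 1 : ℕ) : ℝ))))
      (fun z : Fin N → Euc d => h (padFirst k z) * h (padSecond k ℓ z)), mul_comm]
    rfl
  rw [hsplit] at hlim
  refine hlim.congr' ?_
  filter_upwards [eventually_gt_atTop 0] with R hR
  rw [integral_div, integral_comp_clusterMap hR (hGm R), mul_comm (R ^ d), ← div_div, div_right_comm,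
    inv_mul_eq_div]

end OverlapIntegral

theorem tendsto_layer_radius_power {d k : ℕ} {α : ℝ} {f : ℝ → ℝ} {Ck : ℝ} (hCkpos : 0 < Ck)
    {Rk : ℝ → ℝ}
    (hRklim : Tendsto (fun t => t ^ k * Rk t ^ d * f (Rk t) ^ k) atTop (𝓝 (α * k - d)))
    {m : ℕ → ℕ} (ht : Tendsto (fun n : ℕ => Ck * n / m n) atTop atTop) :
    Tendsto (fun n : ℕ => (n : ℝ) ^ k * Rk (Ck * n / m n) ^ d * f (Rk (Ck * n / m n)) ^ k /
      (m n : ℝ) ^ k) atTop (𝓝 ((α * k - d) / Ck ^ k)) := by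
  refine ((hRklim.comp ht).div_const (Ck ^ k)).congr fun n => ?_
  simp only [Function.comp_apply]
  rw [div_pow, mul_pow]
  field_simp

theorem tendsto_layer_time {Ck : ℝ} (hCkpos : 0 < Ck) {m : ℕ → ℕ} (hm : Tendsto m atTop atTop)
    (hmn : Tendsto (fun n => (m n : ℝ) / n) atTop (𝓝 0)) :
    Tendsto (fun n : ℕ => Ck * n / m n) atTop atTop := by
  have h1 : Tendsto (fun n => (m n : ℝ) / n) atTop (𝓝[>] 0) := by
    refine tendsto_nhdsWithin_iff.2 ⟨hmn, ?_⟩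
    filter_upwards [hm.eventually_gt_atTop 0, eventually_gt_atTop 0] with n h1 h2
    have h1' : (0 : ℝ) < m n := Nat.cast_pos.2 h1
    have h2' : (0 : ℝ) < n := Nat.cast_pos.2 h2
    exact div_pos h1' h2'
  refine ((tendsto_inv_nhdsGT_zero.comp h1).const_mul_atTop hCkpos).congr fun n => ?_
  simp only [Function.comp_apply]
  rw [inv_div, mul_div_assoc]

/-- Lemma 6.1(ii), the covariance asymptotics of the layered tail empirical
measure, in the three regimes of `n f(R_k(C_k n/m))`. -/
theorem layered_covariance_convergence
    (d k : ℕ) (hd : 1 ≤ d) (hk : 1 ≤ k) (α : ℝ) (hα : (d : ℝ) < α)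
    (f : ℝ → ℝ) (hfm : Measurable f) (hfnn : ∀ r, 0 ≤ f r)
    (hfprob : (∫ x : Euc d, f ‖x‖) = 1)
    (hfpos : ∀ᶠ r in atTop, 0 < f r)
    (hfreg : ∀ r : ℝ, 0 < r → Tendsto (fun t => f (t * r) / f t) atTop (𝓝 (r ^ (-α))))
    (h : (Fin k → Euc d) → ℝ) (hhm : Measurable h)
    (hh01 : ∀ y, h y = 0 ∨ h y = 1)
    (hhperm : ∀ (σ : Equiv.Perm (Fin k)) (y : Fin k → Euc d), h (y ∘ σ) = h y)
    (hhtrans : ∀ (x : Euc d) (y : Fin k → Euc d), h (fun i => x + y i) = h y)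
    (L : ℝ) (hL : 0 < L)
    (hhdiam : ∀ y : Fin k → Euc d, (∃ i j, L < dist (y i) (y j)) → h y = 0)
    (hh1 : k = 1 → ∀ y, h y = 1)
    (Ck : ℝ) (hCkpos : 0 < Ck)
    (hCkdef : Ck ^ k = sArea d / (Nat.factorial k) *
      ∫ z : Fin (k - 1) → Euc d, h (padFirst k z))
    (Rk : ℝ → ℝ) (hRkmono : MonotoneOn Rk (Set.Ici 0))
    (hRknn : ∀ t ∈ Set.Ici (0 : ℝ), 0 ≤ Rk t)
    (hRkinf : Tendsto Rk atTop atTop)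
    (hRklim : Tendsto (fun t => t ^ k * Rk t ^ d * f (Rk t) ^ k) atTop (𝓝 (α * k - d)))
    (m : ℕ → ℕ) (hm : Tendsto m atTop atTop)
    (hmn : Tendsto (fun n => (m n : ℝ) / n) atTop (𝓝 0))
    (φ₁ : (Fin k → Euc d) → ℝ) (hφ₁c : Continuous φ₁) (hφ₁nn : ∀ x, 0 ≤ φ₁ x)
    (hφ₁b : ∃ M, ∀ x, φ₁ x ≤ M)
    (hφ₁0 : ∃ a > 0, ∀ x : Fin k → Euc d, (∃ i, ‖x i‖ ≤ a) → φ₁ x = 0)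
    (φ₂ : (Fin k → Euc d) → ℝ) (hφ₂c : Continuous φ₂) (hφ₂nn : ∀ x, 0 ≤ φ₂ x)
    (hφ₂b : ∃ M, ∀ x, φ₂ x ≤ M)
    (hφ₂0 : ∃ a > 0, ∀ x : Fin k → Euc d, (∃ i, ‖x i‖ ≤ a) → φ₂ x = 0) :
    (Tendsto (fun n : ℕ => (n : ℝ) * f (Rk (Ck * n / m n))) atTop (𝓝 0) →
      Tendsto (fun n : ℕ =>
          Sfun d k f h φ₁ φ₂ (Rk (Ck * n / m n)) n / (m n : ℝ) ^ k)
        atTop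
        (𝓝 ((α * k - d) * Dfun d k k h / (Nat.factorial k * Ck ^ k) *
          diagInt d k φ₁ φ₂ (α * (k : ℝ))))) ∧
    (∀ ξ : ℝ, 0 < ξ →
      Tendsto (fun n : ℕ => (n : ℝ) * f (Rk (Ck * n / m n))) atTop (𝓝 ξ) →
      Tendsto (fun n : ℕ =>
          Sfun d k f h φ₁ φ₂ (Rk (Ck * n / m n)) n / (m n : ℝ) ^ k)
        atTop
        (𝓝 (∑ ℓ ∈ Finset.Icc 1 k,
          ξ ^ (k - ℓ) * (α * k - d) * Dfun d k ℓ h /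
              ((Nat.factorial ℓ : ℝ) * (Nat.factorial (k - ℓ) : ℝ) ^ 2 * Ck ^ k) *
            diagInt d k φ₁ φ₂ (α * ((2 * k - ℓ : ℕ) : ℝ))))) ∧
    (Tendsto (fun n : ℕ => (n : ℝ) * f (Rk (Ck * n / m n))) atTop atTop →
      Tendsto (fun n : ℕ =>
          Sfun d k f h φ₁ φ₂ (Rk (Ck * n / m n)) n /
            ((m n : ℝ) ^ k * ((n : ℝ) * f (Rk (Ck * n / m n))) ^ (k - 1)))
        atTop
        (𝓝 ((α * k - d) * Dfun d k 1 h / ((Nat.factorial (k - 1) : ℝ) ^ 2 * Ck ^ k) *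
          diagInt d k φ₁ φ₂ (α * ((2 * k - 1 : ℕ) : ℝ))))) := by
  have ht := tendsto_layer_time hCkpos hm hmn
  have hρ := hRkinf.comp ht
  have hpow := tendsto_layer_radius_power hCkpos hRklim ht
  set ρ : ℕ → ℝ := fun n => Rk (Ck * n / m n)
  change Tendsto (fun n : ℕ => (n : ℝ) ^ k * ρ n ^ d * f (ρ n) ^ k / (m n : ℝ) ^ k) _ _ at hpow
  change Tendsto ρ atTop atTop at hρ
  have hterm : ∀ ℓ ∈ Finset.Icc 1 k, ∀ (κ : ℕ → ℝ) (c : ℝ),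
      Tendsto (fun n : ℕ => ((n : ℝ) * f (ρ n)) ^ (k - ℓ) / κ n) atTop (𝓝 c) →
      Tendsto (fun n : ℕ => (n : ℝ) ^ (2 * k - ℓ) * Ifun d k ℓ f h φ₁ φ₂ (ρ n) /
        ((Nat.factorial ℓ : ℝ) * (Nat.factorial (k - ℓ) : ℝ) ^ 2) / ((m n : ℝ) ^ k * κ n))
        atTop (𝓝 (c * (α * k - d) * Dfun d k ℓ h /
          ((Nat.factorial ℓ : ℝ) * (Nat.factorial (k - ℓ) : ℝ) ^ 2 * Ck ^ k) *
            diagInt d k φ₁ φ₂ (α * ((2 * k - ℓ : ℕ) : ℝ)))) := by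
    intro ℓ hℓ κ c hκ
    rw [Finset.mem_Icc] at hℓ
    have hI := (tendsto_overlap_integral_div (N := 2 * k - ℓ - 1) (n := 2 * k - ℓ) (by omega) rfl
      hℓ.1 hℓ.2 hα hfm hfnn hfpos hfreg hhm hh01 hhtrans hhdiam hφ₁c hφ₁nn hφ₁b hφ₁0 hφ₂c hφ₂nn
      hφ₂b hφ₂0).comp hρ
    have hall := ((hpow.mul hκ).mul hI).div_const
      ((Nat.factorial ℓ : ℝ) * (Nat.factorial (k - ℓ) : ℝ) ^ 2)
    have hlimit : c * (α * k - d) * Dfun d k ℓ h /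
          ((Nat.factorial ℓ : ℝ) * (Nat.factorial (k - ℓ) : ℝ) ^ 2 * Ck ^ k) *
            diagInt d k φ₁ φ₂ (α * ((2 * k - ℓ : ℕ) : ℝ)) =
        (α * k - d) / Ck ^ k * c * (Dfun d k ℓ h *
          diagInt d k φ₁ φ₂ (α * ((2 * k - ℓ : ℕ) : ℝ))) /
            ((Nat.factorial ℓ : ℝ) * (Nat.factorial (k - ℓ) : ℝ) ^ 2) := by
      field_simp
    rw [hlimit]
    refine hall.congr' ?_
    filter_upwards [hρ.eventually hfpos, hρ.eventually_gt_atTop 0] with n h1 h2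
    change _ * (Ifun d k ℓ f h φ₁ φ₂ (ρ n) / (ρ n ^ d * f (ρ n) ^ (2 * k - ℓ))) / _ = _
    rw [show 2 * k - ℓ = k + (k - ℓ) by omega, pow_add, pow_add, mul_pow]
    field_simp
  have hsum : ∀ (κ : ℕ → ℝ) (c : ℕ → ℝ),
      (∀ ℓ ∈ Finset.Icc 1 k,
        Tendsto (fun n : ℕ => ((n : ℝ) * f (ρ n)) ^ (k - ℓ) / κ n) atTop (𝓝 (c ℓ))) →
      Tendsto (fun n : ℕ => Sfun d k f h φ₁ φ₂ (ρ n) n / ((m n : ℝ) ^ k * κ n)) atTop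
        (𝓝 (∑ ℓ ∈ Finset.Icc 1 k, c ℓ * (α * k - d) * Dfun d k ℓ h /
          ((Nat.factorial ℓ : ℝ) * (Nat.factorial (k - ℓ) : ℝ) ^ 2 * Ck ^ k) *
            diagInt d k φ₁ φ₂ (α * ((2 * k - ℓ : ℕ) : ℝ)))) := by
    intro κ c hc
    refine (tendsto_finsetSum _ fun ℓ hℓ => hterm ℓ hℓ κ (c ℓ) (hc ℓ hℓ)).congr fun n => ?_
    rw [Sfun, Finset.sum_div]
  refine ⟨fun h0 => ?_, fun ξ hξ hlim => ?_, fun hinf => ?_⟩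
  · have key := hsum (fun _ => 1) (fun ℓ => if ℓ = k then 1 else 0) fun ℓ hℓ => by
      rw [Finset.mem_Icc] at hℓ
      have := h0.pow (k - ℓ)
      simp only [div_one]
      split_ifs with hlk
      · simp [hlk]
      · rwa [zero_pow (by omega)] at this
    simp only [mul_one] at key
    rw [Finset.sum_eq_single k] at key
    · simp only [if_true, one_mul, Nat.sub_self, Nat.factorial_zero, Nat.cast_one, one_pow,
        mul_one, show 2 * k - k = k by omega] at key
      exact key
    · intro ℓ _ hlk
      simp [hlk]
    · intro hnot
      exact absurd (Finset.mem_Icc.2 ⟨hk, le_rfl⟩) hnot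
  · have key := hsum (fun _ => 1) (fun ℓ => ξ ^ (k - ℓ)) fun ℓ hℓ => by
      simpa only [div_one] using hlim.pow (k - ℓ)
    simpa only [mul_one] using key
  · have key := hsum (fun n => ((n : ℝ) * f (ρ n)) ^ (k - 1)) (fun ℓ => if ℓ = 1 then 1 else 0)
      fun ℓ hℓ => by
        rw [Finset.mem_Icc] at hℓ
        split_ifs with hl1
        · subst hl1
          refine tendsto_const_nhds.congr' ?_
          filter_upwards [hinf.eventually_gt_atTop 0] with n hn
          exact (div_self (pow_pos hn _).ne').symm
        · have h1 : Tendsto (fun n : ℕ => (((n : ℝ) * f (ρ n)) ^ (ℓ - 1))⁻¹) atTop (𝓝 0) :=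
            ((tendsto_pow_atTop (Nat.sub_ne_zero_of_lt (by omega))).comp hinf).inv_tendsto_atTop
          refine h1.congr' ?_
          filter_upwards [hinf.eventually_gt_atTop 0] with n hn
          have hn' : (n : ℝ) * f (ρ n) ≠ 0 := ne_of_gt hn
          rw [show k - 1 = (k - ℓ) + (ℓ - 1) by omega, pow_add,
            div_mul_cancel_left₀ (pow_ne_zero _ hn')]
    rw [Finset.sum_eq_single 1] at key
    · simpa only [if_true, one_mul, Nat.factorial_one, Nat.cast_one] using key
    · intro ℓ _ hl1
      simp [hl1]
    · intro hnot
      exact absurd (Finset.mem_Icc.2 ⟨le_rfl, hk⟩) hnot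
end
end
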